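/- Let w ∈ S_N. If w has no N-occurrence of any of the patterns 4321, 45312, and 53412, then every N-occurrence of the pattern 321 in w is equal to 𝔭_k(w) for some k ∈ newrep(w). -/

import Mathlib

/-!
Common framework.  Permutations of `{1, …, m}` are modelled as `Equiv.Perm (Fin m)`
with 0-based positions and values.  The simple reflection `sr m i` (for
`0 ≤ i ≤ m - 2`, corresponding to the paper's `s_{i+1}`) swaps the values `i` and
`i + 1`.  Cut statistics `Mstat w k` / `mstat w k` (the paper's `M_{k+1}`/`m_{k+1}`)
are respectively the maximum of the first `k + 1` entries and the minimum of the
remaining entries of the one-line notation of `w`.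
-/

/-- The simple reflection swapping `i` and `i + 1` (0-based) in the symmetric group
on `Fin m`; the identity if out of range. -/
def sr (m i : ℕ) : Equiv.Perm (Fin m) :=
  if h : i + 1 < m then Equiv.swap ⟨i, Nat.lt_of_succ_lt h⟩ ⟨i + 1, h⟩ else 1

/-- `l` is a word in the simple reflections whose product is `w`. -/
def IsWord (m : ℕ) (l : List ℕ) (w : Equiv.Perm (Fin m)) : Prop :=
  (∀ i ∈ l, i + 1 < m) ∧ (l.map (sr m)).prod = w

/-- The Coxeter length `ℓ(w)`: the minimal length of a word expressing `w`. -/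
noncomputable def len {m : ℕ} (w : Equiv.Perm (Fin m)) : ℕ :=
  sInf {c | ∃ l : List ℕ, IsWord m l w ∧ l.length = c}

/-- `l` is a reduced decomposition of `w`. -/
def IsReducedWord {m : ℕ} (w : Equiv.Perm (Fin m)) (l : List ℕ) : Prop :=
  IsWord m l w ∧ l.length = len w

/-- The support of `w`: the letters appearing in some reduced decomposition. -/
noncomputable def supp {m : ℕ} (w : Equiv.Perm (Fin m)) : Set ℕ :=
  {i | ∃ l : List ℕ, IsReducedWord w l ∧ i ∈ l}

/-- `rep w = ℓ(w) - |supp w|`, the number of repeated letters. -/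
noncomputable def rep {m : ℕ} (w : Equiv.Perm (Fin m)) : ℕ :=
  len w - (supp w).ncard

/-- The value of `w` at the (0-based) position `i`, as a natural number. -/
def valAt {m : ℕ} (w : Equiv.Perm (Fin m)) (i : ℕ) : ℕ :=
  if h : i < m then (w ⟨i, h⟩ : ℕ) else 0

/-- The (0-based) position at which the value `v` occurs in `w`. -/
def posOf {m : ℕ} (w : Equiv.Perm (Fin m)) (v : ℕ) : ℕ :=
  if h : v < m then (w⁻¹ ⟨v, h⟩ : ℕ) else 0

/-- `Mstat w k`: the maximum of the first `k + 1` entries of `w`. -/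
noncomputable def Mstat {m : ℕ} (w : Equiv.Perm (Fin m)) (k : ℕ) : ℕ :=
  sSup {v | ∃ i : Fin m, (i : ℕ) ≤ k ∧ (w i : ℕ) = v}

/-- `mstat w k`: the minimum of the entries of `w` in positions `> k`. -/
noncomputable def mstat {m : ℕ} (w : Equiv.Perm (Fin m)) (k : ℕ) : ℕ :=
  sInf {v | ∃ i : Fin m, k < (i : ℕ) ∧ (w i : ℕ) = v}

/-- `wbar` is obtained from `w` by deleting the largest letter from the one-line
notation of `w` and sliding all subsequent letters one space to the left. -/
def IsDeletion {n : ℕ} (w : Equiv.Perm (Fin (n + 1))) (wbar : Equiv.Perm (Fin n)) : Prop :=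
  ∀ i : Fin n, (wbar i : ℕ) =
    if (i : ℕ) < posOf w n then valAt w (i : ℕ) else valAt w ((i : ℕ) + 1)

/-- `newrep w wbar`: the letters `k` with `s_k ∈ supp(wbar)` and `w⁻¹(top) ≤ k`. -/
noncomputable def newrep {n : ℕ} (w : Equiv.Perm (Fin (n + 1))) (wbar : Equiv.Perm (Fin n)) :
    Set ℕ :=
  {k | k ∈ supp wbar ∧ posOf w n ≤ k}

/-- An occurrence of the pattern `p` in `w`, recorded by its set `S` of values:
there are positions `f 0 < f 1 < ⋯` whose values are in the same relative order
as `p`, and `S` is the corresponding set of values. -/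
def IsOccSet {m c : ℕ} (p : Fin c → ℕ) (w : Equiv.Perm (Fin m)) (S : Finset ℕ) : Prop :=
  ∃ f : Fin c → Fin m, StrictMono f ∧ (∀ a b : Fin c, p a < p b ↔ w (f a) < w (f b)) ∧
    S = Finset.image (fun a => (w (f a) : ℕ)) Finset.univ

/-- An `N`-occurrence (here `N = n`, the largest 0-based value): an occurrence
whose largest letter is the largest value of `w`. -/
def IsTopOccSet {n c : ℕ} (p : Fin c → ℕ) (w : Equiv.Perm (Fin (n + 1))) (S : Finset ℕ) : Prop :=
  IsOccSet p w S ∧ n ∈ S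

/-- The number of occurrences of the pattern `p` in `w`. -/
noncomputable def occCount {m c : ℕ} (p : Fin c → ℕ) (w : Equiv.Perm (Fin m)) : ℕ :=
  Set.ncard {S : Finset ℕ | IsOccSet p w S}

/-- The number of `N`-occurrences of the pattern `p` in `w`. -/
noncomputable def topOccCount {n c : ℕ} (p : Fin c → ℕ) (w : Equiv.Perm (Fin (n + 1))) : ℕ :=
  Set.ncard {S : Finset ℕ | IsTopOccSet p w S}

def p321 : Fin 3 → ℕ := ![3, 2, 1]
def p3412 : Fin 4 → ℕ := ![3, 4, 1, 2]
def p4321 : Fin 4 → ℕ := ![4, 3, 2, 1]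
def p34512 : Fin 5 → ℕ := ![3, 4, 5, 1, 2]
def p45123 : Fin 5 → ℕ := ![4, 5, 1, 2, 3]
def p35412 : Fin 5 → ℕ := ![3, 5, 4, 1, 2]
def p43512 : Fin 5 → ℕ := ![4, 3, 5, 1, 2]
def p45132 : Fin 5 → ℕ := ![4, 5, 1, 3, 2]
def p45213 : Fin 5 → ℕ := ![4, 5, 2, 1, 3]
def p53412 : Fin 5 → ℕ := ![5, 3, 4, 1, 2]
def p45312 : Fin 5 → ℕ := ![4, 5, 3, 1, 2]
def p45231 : Fin 5 → ℕ := ![4, 5, 2, 3, 1]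

/-- The pattern `𝔭_k(w)` of Definition 4.4, recorded as its set of values:
(I) if `w⁻¹(top)` is left of `w⁻¹(M_k)`, the 321-occurrence `{top, M_k, m_k}`;
(II) else if `wbar(k) > m_k`, the 321-occurrence `{top, wbar(k), m_k}`;
(III) otherwise the 3412-occurrence `{M_k, top, wbar(k), m_k}`. -/
noncomputable def pocc {n : ℕ} (w : Equiv.Perm (Fin (n + 1))) (wbar : Equiv.Perm (Fin n))
    (k : ℕ) : Finset ℕ :=
  if posOf w n < posOf w (Mstat wbar k) then {n, Mstat wbar k, mstat wbar k}
  else if mstat wbar k < valAt wbar k then {n, valAt wbar k, mstat wbar k}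
  else {Mstat wbar k, n, valAt wbar k, mstat wbar k}

/-- The set of positions `≤ k` is preserved by every simple reflection other than `s_k`. -/
theorem sr_le_iff {m i k : ℕ} (hik : i ≠ k) (x : Fin m) :
    (sr m i x : ℕ) ≤ k ↔ (x : ℕ) ≤ k := by
  unfold sr
  split_ifs with h
  · rw [Equiv.swap_apply_def]
    split_ifs with h1 h2
    · subst h1; simp only; omega
    · subst h2; simp only; omega
    · rfl
  · rfl

theorem word_prod_le_iff {m k : ℕ} (l : List ℕ) (hl : k ∉ l) (x : Fin m) :
    ((l.map (sr m)).prod x : ℕ) ≤ k ↔ (x : ℕ) ≤ k := by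
  induction l with
  | nil => simp
  | cons a l ih =>
    simp only [List.mem_cons, not_or] at hl
    rw [List.map_cons, List.prod_cons, Equiv.Perm.mul_apply, sr_le_iff (Ne.symm hl.1), ih hl.2]

theorem exists_isWord {m : ℕ} (w : Equiv.Perm (Fin m)) : ∃ l, IsWord m l w := by
  cases m with
  | zero => exact ⟨[], by simp, Subsingleton.elim _ _⟩
  | succ m =>
    have hw : w ∈ Submonoid.closure
        (Set.range fun i : Fin m ↦ Equiv.swap i.castSucc i.succ) := by
      rw [Equiv.Perm.mclosure_swap_castSucc_succ]; trivial
    induction hw using Submonoid.closure_induction with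
    | mem x hx =>
      obtain ⟨i, rfl⟩ := hx
      refine ⟨[i], by simp, ?_⟩
      simp only [List.map_cons, List.map_nil, List.prod_singleton, sr, add_lt_add_iff_right,
        i.isLt, dif_pos]
      rfl
    | one => exact ⟨[], by simp, rfl⟩
    | mul x y _ _ hx hy =>
      obtain ⟨a, ha, rfl⟩ := hx
      obtain ⟨b, hb, rfl⟩ := hy
      refine ⟨a ++ b, fun i hi ↦ ?_, by simp⟩
      rcases List.mem_append.1 hi with h | h
      exacts [ha i h, hb i h]

theorem exists_isReducedWord {m : ℕ} (w : Equiv.Perm (Fin m)) : ∃ l, IsReducedWord w l := by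
  obtain ⟨l, hl⟩ := exists_isWord w
  exact Nat.sInf_mem (s := {c | ∃ l : List ℕ, IsWord m l w ∧ l.length = c}) ⟨_, l, hl, rfl⟩

/-- If `s_k` is not in the support, `w` preserves the positions `≤ k`. -/
theorem le_iff_of_notMem_supp {m k : ℕ} {w : Equiv.Perm (Fin m)} (hk : k ∉ supp w) (x : Fin m) :
    (w x : ℕ) ≤ k ↔ (x : ℕ) ≤ k := by
  obtain ⟨l, hl⟩ := exists_isReducedWord w
  rw [← word_prod_le_iff l (fun h ↦ hk ⟨l, hl, h⟩) x, hl.1.2]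

theorem mem_supp_of_inversion {m k : ℕ} {w : Equiv.Perm (Fin m)} {i j : Fin m}
    (hi : (i : ℕ) ≤ k) (hj : k < (j : ℕ)) (h : w j < w i) : k ∈ supp w := by
  by_contra hk
  have := (le_iff_of_notMem_supp hk i).2 hi
  have := (le_iff_of_notMem_supp hk j).not.2 hj.not_ge
  omega

theorem Mstat_eq {m k : ℕ} {w : Equiv.Perm (Fin m)} {j : Fin m} (hj : (j : ℕ) ≤ k)
    (h : ∀ i : Fin m, (i : ℕ) ≤ k → w i ≤ w j) : Mstat w k = w j :=
  IsGreatest.csSup_eq ⟨⟨j, hj, rfl⟩, by rintro _ ⟨i, hi, rfl⟩; exact h i hi⟩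

theorem mstat_eq {m k : ℕ} {w : Equiv.Perm (Fin m)} {j : Fin m} (hj : k < (j : ℕ))
    (h : ∀ i : Fin m, k < (i : ℕ) → w j ≤ w i) : mstat w k = w j :=
  IsLeast.csInf_eq ⟨⟨j, hj, rfl⟩, by rintro _ ⟨i, hi, rfl⟩; exact h i hi⟩

theorem exists_Mstat_eq {m k : ℕ} (w : Equiv.Perm (Fin m)) (hk : k < m) :
    ∃ j : Fin m, (j : ℕ) ≤ k ∧ (∀ i : Fin m, (i : ℕ) ≤ k → w i ≤ w j) ∧ Mstat w k = w j := by
  obtain ⟨j, hj, h⟩ := (Set.toFinite {i : Fin m | (i : ℕ) ≤ k}).exists_maximalFor w _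
    ⟨⟨k, hk⟩, le_refl k⟩
  have h' : ∀ i : Fin m, (i : ℕ) ≤ k → w i ≤ w j := fun i hi ↦
    (le_total (w i) (w j)).elim id fun hle ↦ h hi hle
  exact ⟨j, hj, h', Mstat_eq hj h'⟩

theorem posOf_val {m : ℕ} (w : Equiv.Perm (Fin m)) (i : Fin m) : posOf w (w i) = i := by
  simp [posOf]

theorem valAt_val {m : ℕ} (w : Equiv.Perm (Fin m)) (i : Fin m) : valAt w i = w i := by
  simp [valAt]

theorem posOf_top {n : ℕ} {w : Equiv.Perm (Fin (n + 1))} {p : Fin (n + 1)}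
    (hp : w p = Fin.last n) : posOf w n = p := by
  rw [← posOf_val w p, hp, Fin.val_last]

theorem IsDeletion.val_eq {n : ℕ} {w : Equiv.Perm (Fin (n + 1))} {wbar : Equiv.Perm (Fin n)}
    (hdel : IsDeletion w wbar) {p : Fin (n + 1)} (hp : w p = Fin.last n) (i : Fin n) :
    (wbar i : ℕ) = w (p.succAbove i) := by
  rw [hdel i, posOf_top hp, Fin.succAbove, ← valAt_val, apply_ite Fin.val]
  simp only [Fin.lt_def, Fin.val_castSucc, Fin.val_succ]
  split_ifs <;> rfl

theorem isTopOccSet_of_mem {n c : ℕ} {p : Fin c → ℕ} {w : Equiv.Perm (Fin (n + 1))}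
    {f : Fin c → Fin (n + 1)} (hf : StrictMono f)
    (h : ∀ a b : Fin c, p a < p b ↔ w (f a) < w (f b)) (a : Fin c) (ha : w (f a) = Fin.last n) :
    ∃ S, IsTopOccSet p w S :=
  ⟨_, ⟨f, hf, h, rfl⟩, Finset.mem_image.2 ⟨a, Finset.mem_univ a, by simp [ha]⟩⟩

theorem exists_top_4321 {n : ℕ} {w : Equiv.Perm (Fin (n + 1))} {p a b c : Fin (n + 1)}
    (hp : w p = Fin.last n) (hpa : p < a) (hab : a < b) (hbc : b < c)
    (h1 : w b < w a) (h2 : w c < w b) : ∃ S, IsTopOccSet p4321 w S := by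
  have h0 : w a < w p := by
    rw [hp]; exact Fin.lt_last_iff_ne_last.2 fun h ↦ hpa.ne' (w.injective (h.trans hp.symm))
  refine isTopOccSet_of_mem (f := ![p, a, b, c]) ?_ ?_ 0 hp
  · simp [Fin.strictMono_iff_lt_succ, Fin.forall_fin_succ, *]
  · simp [Fin.forall_fin_succ, p4321]
    omega

theorem exists_top_53412 {n : ℕ} {w : Equiv.Perm (Fin (n + 1))} {p a b c d : Fin (n + 1)}
    (hp : w p = Fin.last n) (hpa : p < a) (hab : a < b) (hbc : b < c) (hcd : c < d)
    (h1 : w a < w b) (h2 : w d < w a) (h3 : w c < w d) : ∃ S, IsTopOccSet p53412 w S := by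
  have h0 : w b < w p := by
    rw [hp]
    exact Fin.lt_last_iff_ne_last.2 fun h ↦ (hpa.trans hab).ne' (w.injective (h.trans hp.symm))
  refine isTopOccSet_of_mem (f := ![p, a, b, c, d]) ?_ ?_ 0 hp
  · simp [Fin.strictMono_iff_lt_succ, Fin.forall_fin_succ, *]
  · simp [Fin.forall_fin_succ, p53412]
    omega

theorem exists_top_45312 {n : ℕ} {w : Equiv.Perm (Fin (n + 1))} {p a b c d : Fin (n + 1)}
    (hp : w p = Fin.last n) (hap : a < p) (hpb : p < b) (hbc : b < c) (hcd : c < d)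
    (h1 : w b < w a) (h2 : w d < w b) (h3 : w c < w d) : ∃ S, IsTopOccSet p45312 w S := by
  have h0 : w a < w p := by
    rw [hp]; exact Fin.lt_last_iff_ne_last.2 fun h ↦ hap.ne (w.injective (h.trans hp.symm))
  refine isTopOccSet_of_mem (f := ![a, p, b, c, d]) ?_ ?_ 1 hp
  · simp [Fin.strictMono_iff_lt_succ, Fin.forall_fin_succ, *]
  · simp [Fin.forall_fin_succ, p45312]
    omega

/-- A top 321-occurrence is given by an inversion after the largest letter. -/
theorem exists_of_top_321 {n : ℕ} {w : Equiv.Perm (Fin (n + 1))} {S : Finset ℕ}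
    (hS : IsTopOccSet p321 w S) :
    ∃ p b a : Fin (n + 1), w p = Fin.last n ∧ p < b ∧ b < a ∧ w a < w b ∧
      S = {n, (w b : ℕ), (w a : ℕ)} := by
  obtain ⟨⟨f, hf, h, rfl⟩, hn⟩ := hS
  have h10 : w (f 1) < w (f 0) := (h 1 0).1 (by simp [p321])
  have h21 : w (f 2) < w (f 1) := (h 2 1).1 (by simp [p321])
  have h0 : (w (f 0) : ℕ) = n := by
    obtain ⟨a, -, ha⟩ := Finset.mem_image.1 hn
    fin_cases a <;> simp at ha <;> omega
  refine ⟨f 0, f 1, f 2, Fin.ext h0, hf (by decide), hf (by decide), h21, ?_⟩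
  ext x
  simp [Fin.exists_fin_succ, h0, eq_comm]

/-- if `w` has no `N`-occurrence of 4321, 45312, or 53412, then every
`N`-occurrence of 321 in `w` equals `𝔭_k(w)` for some `k ∈ newrep(w)`. -/
theorem all_top_321_are_pocc {n : ℕ} (w : Equiv.Perm (Fin (n + 1)))
    (wbar : Equiv.Perm (Fin n)) (hdel : IsDeletion w wbar)
    (h1 : ¬ ∃ S : Finset ℕ, IsTopOccSet p4321 w S)
    (h2 : ¬ ∃ S : Finset ℕ, IsTopOccSet p45312 w S)
    (h3 : ¬ ∃ S : Finset ℕ, IsTopOccSet p53412 w S) :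
    ∀ S : Finset ℕ, IsTopOccSet p321 w S → ∃ k ∈ newrep w wbar, pocc w wbar k = S := by
  intro S hS
  obtain ⟨p, b, a, hp, hpb, hba, hlt, rfl⟩ := exists_of_top_321 hS
  obtain ⟨j, rfl⟩ := Fin.exists_succAbove_eq hpb.ne'
  obtain ⟨l, rfl⟩ := Fin.exists_succAbove_eq (hpb.trans hba).ne'
  have hv := hdel.val_eq hp
  have hvlt : ∀ {x y : Fin n}, wbar x < wbar y ↔ w (p.succAbove x) < w (p.succAbove y) := by
    intro x y; rw [Fin.lt_def, Fin.lt_def, hv, hv]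
  have hmono : ∀ {x y : Fin n}, x < y ↔ p.succAbove x < p.succAbove y :=
    (Fin.strictMono_succAbove p).lt_iff_lt.symm
  have hpos : ∀ {x : Fin n}, p < p.succAbove x ↔ (p : ℕ) ≤ x := by
    intro x; rw [Fin.lt_succAbove_iff_le_castSucc, Fin.le_def, Fin.val_castSucc]
  have hpos' : ∀ x : Fin n, posOf w (wbar x) = p.succAbove x := by
    intro x; rw [hv, posOf_val]
  have hjl : j < l := hmono.2 hba
  have hlj : wbar l < wbar j := hvlt.2 hlt
  have hpj : (p : ℕ) ≤ j := hpos.1 hpb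
  have no4321 : ∀ x y z : Fin n, (p : ℕ) ≤ x → x < y → y < z →
      wbar y < wbar x → ¬ wbar z < wbar y := fun x y z hx hxy hyz hyx hzy ↦
    h1 (exists_top_4321 hp (hpos.2 hx) (hmono.1 hxy) (hmono.1 hyz) (hvlt.1 hyx) (hvlt.1 hzy))
  rw [← hv, ← hv]
  by_cases hmax : ∃ c, c < j ∧ wbar j < wbar c
  · obtain ⟨c, hcj, hjc⟩ := hmax
    have left : ∀ x, x < j → wbar j < wbar x → (x : ℕ) < p := fun x hxj hjx ↦ by
      by_contra! hx
      exact no4321 x j l hx hxj hjl hjx hlj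
    have hm : mstat wbar j = wbar l := by
      refine mstat_eq hjl fun x hx ↦ ?_
      by_contra! hxl
      rcases lt_trichotomy x l with h | rfl | h
      · have hcp : p.succAbove c < p :=
          Fin.succAbove_lt_iff_castSucc_lt _ _ |>.2 (left c hcj hjc)
        exact h2 (exists_top_45312 hp hcp hpb (hmono.1 hx) (hmono.1 h) (hvlt.1 hjc) hlt
          (hvlt.1 hxl))
      · exact lt_irrefl _ hxl
      · exact no4321 j l x hpj hjl h hlj hxl
    obtain ⟨x, hxj, hx, hM⟩ := exists_Mstat_eq wbar j.isLt
    have hjx : wbar j < wbar x := hjc.trans_le (hx c hcj.le)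
    have hxj' : x < j := lt_of_le_of_ne hxj (by rintro rfl; exact lt_irrefl _ hjx)
    refine ⟨j, ⟨mem_supp_of_inversion le_rfl hjl hlj, (posOf_top hp).trans_le hpj⟩, ?_⟩
    rw [pocc, hM, hm, hpos', valAt_val, posOf_top hp, if_neg, if_pos (Fin.lt_def.1 hlj)]
    exact fun h ↦ absurd (hpos.1 h) (left x hxj' hjx).not_ge
  · push Not at hmax
    -- `k` is the last position between `j` and `l` of a letter below `wbar l`, or `j` if none.
    obtain ⟨k, ⟨hjk, hkl, hk⟩, hkmax⟩ :=
      (Set.toFinite {x | j ≤ x ∧ x < l ∧ (x = j ∨ wbar x < wbar l)}).exists_maximalFor id _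
        ⟨j, le_rfl, hjl, Or.inl rfl⟩
    have hm : mstat wbar k = wbar l := by
      refine mstat_eq hkl fun x hx ↦ ?_
      by_contra! hxl
      rcases lt_trichotomy x l with h | rfl | h
      · exact (hkmax ⟨hjk.trans (le_of_lt hx), h, Or.inr hxl⟩ (le_of_lt hx)).not_gt hx
      · exact lt_irrefl _ hxl
      · exact no4321 j l x hpj hjl h hlj hxl
    have hM : Mstat wbar k = wbar j := by
      refine Mstat_eq hjk fun x hx ↦ ?_
      by_contra! hjx
      have hxj : j < x := lt_of_le_of_ne
        (by by_contra! h; exact (hmax x h).not_gt hjx) (by rintro rfl; exact lt_irrefl _ hjx)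
      have hkl' : wbar k < wbar l := hk.resolve_left (hxj.trans_le hx).ne'
      have hxk : x < k := lt_of_le_of_ne hx
        (by rintro rfl; exact lt_asymm hjx (hkl'.trans hlj))
      exact h3 (exists_top_53412 hp hpb (hmono.1 hxj) (hmono.1 hxk) (hmono.1 hkl)
        (hvlt.1 hjx) hlt (hvlt.1 hkl'))
    refine ⟨k, ⟨mem_supp_of_inversion hjk hkl hlj, (posOf_top hp).trans_le (hpj.trans hjk)⟩, ?_⟩
    rw [pocc, hM, hm, hpos', posOf_top hp, if_pos (Fin.lt_def.1 hpb)]
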